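/- arXiv:2603.25550 — 9 statements merged into one kernel-verified Lean document; each statement's English description precedes it below -/
import Mathlib

section
/- Let n : ℕ and let φ be a formula of the empty first-order language with free variables indexed by Fin n. Let M and N be types admitting a bijection e : M ≃ N, and let v : Fin n → M and w : Fin n → N be assignments with the same equality pattern. Then φ.Realize v ↔ φ.Realize w. In other words, the truth of an empty-language formula depends only on the equality pattern of the assigned tuple and the cardinality of the underlying structure. -/
open FirstOrder

attribute [local instance] FirstOrder.Language.emptyStructure

/-- Two finite families in a type with the same equality pattern are conjugate under a
permutation. -/
theorem Equiv.Perm.exists_apply_eq_of_same_pattern {ι α : Type*} [Finite ι] (u w : ι → α)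
    (h : ∀ i j, u i = u j ↔ w i = w j) : ∃ σ : Equiv.Perm α, ∀ i, σ (u i) = w i := by
  classical
  have : Finite {x | x ∈ Set.range u} := Set.finite_range u
  let r : {x // x ∈ Set.range u} ≃ {x // x ∈ Set.range w} :=
    (Setoid.quotientKerEquivRange u).symm.trans
      ((Quotient.congrRight h).trans (Setoid.quotientKerEquivRange w))
  have hr : ∀ i, r ⟨u i, i, rfl⟩ = ⟨w i, i, rfl⟩ := fun i => by
    have hu : (Setoid.quotientKerEquivRange u).symm ⟨u i, i, rfl⟩ = Quotient.mk _ i :=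
      (Equiv.symm_apply_eq _).2 rfl
    simp only [r, Equiv.trans_apply, hu]
    rfl
  exact ⟨r.extendSubtype, fun i => by
    rw [r.extendSubtype_apply_of_mem _ ⟨i, rfl⟩, hr]⟩

/-- The truth of an empty-language formula depends only on the equality pattern of the
assigned tuple and the cardinality of the underlying structure. -/
theorem empty_language_realize_iff_of_equiv_of_same_pattern
    {n : ℕ} (φ : Language.empty.Formula (Fin n))
    {M N : Type*} (e : M ≃ N) (v : Fin n → M) (w : Fin n → N)
    (h : ∀ i j : Fin n, v i = v j ↔ w i = w j) :
    φ.Realize v ↔ φ.Realize w := by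
  obtain ⟨σ, hσ⟩ := Equiv.Perm.exists_apply_eq_of_same_pattern (e ∘ v) w
    fun i j => e.injective.eq_iff.trans (h i j)
  have hw : (e.trans σ) ∘ v = w := funext hσ
  rw [← hw]
  exact (Language.StrongHomClass.realize_formula (e.trans σ) φ).symm
end

section
/- Let α be any type and let φ be a formula of the empty first-order language with free variables indexed by α. If M and N are infinite types and v : α → M, w : α → N are assignments with the same equality pattern, then φ.Realize v ↔ φ.Realize w. In particular, over infinite structures the truth of an empty-language formula depends only on the equality pattern of the assignment; this includes the case where v and w are both injective. -/
open FirstOrder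

attribute [local instance] FirstOrder.Language.emptyStructure

/-- The one-point extension property: a point added to a finite assignment can be matched in any
infinite type. -/
theorem exists_forall_eq_iff_eq_of_same_pattern {β M N : Type*} [Finite β] [Infinite N]
    {s : β → M} {t : β → N} (h : ∀ a b, s a = s b ↔ t a = t b) (x : M) :
    ∃ y, ∀ b, s b = x ↔ t b = y := by
  by_cases hx : ∃ a, s a = x
  · obtain ⟨a, rfl⟩ := hx
    exact ⟨t a, fun b => h b a⟩
  · obtain ⟨y, hy⟩ := (Set.finite_range t).exists_notMem
    exact ⟨y, fun b => iff_of_false (fun hb => hx ⟨b, hb⟩) (fun hb => hy ⟨b, hb⟩)⟩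

/-- Extending two assignments by matching points preserves equality of their patterns. -/
theorem same_pattern_snoc {α M N : Type*} {n : ℕ} {v : α → M} {w : α → N}
    {xs : Fin n → M} {ys : Fin n → N}
    (h : ∀ a b, Sum.elim v xs a = Sum.elim v xs b ↔ Sum.elim w ys a = Sum.elim w ys b)
    {x : M} {y : N} (hxy : ∀ b, Sum.elim v xs b = x ↔ Sum.elim w ys b = y)
    (a b : α ⊕ Fin (n + 1)) :
    Sum.elim v (Fin.snoc xs x : Fin (n + 1) → M) a =
        Sum.elim v (Fin.snoc xs x : Fin (n + 1) → M) b ↔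
      Sum.elim w (Fin.snoc ys y : Fin (n + 1) → N) a =
        Sum.elim w (Fin.snoc ys y : Fin (n + 1) → N) b := by
  have key : ∀ c : α ⊕ Fin (n + 1),
      (∃ d, Sum.elim v (Fin.snoc xs x : Fin (n + 1) → M) c = Sum.elim v xs d ∧
        Sum.elim w (Fin.snoc ys y : Fin (n + 1) → N) c = Sum.elim w ys d) ∨
      (Sum.elim v (Fin.snoc xs x : Fin (n + 1) → M) c = x ∧
        Sum.elim w (Fin.snoc ys y : Fin (n + 1) → N) c = y) := by
    rintro (i | j)
    · exact .inl ⟨.inl i, rfl, rfl⟩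
    · induction j using Fin.lastCases with
      | last => exact .inr (by simp)
      | cast j => exact .inl ⟨.inr j, by simp⟩
  rcases key a with ⟨c, ha, ha'⟩ | ⟨ha, ha'⟩ <;> rcases key b with ⟨d, hb, hb'⟩ | ⟨hb, hb'⟩ <;>
    rw [ha, ha', hb, hb']
  · exact h c d
  · exact hxy c
  · rw [eq_comm, hxy d, eq_comm]
  · simp

/-- Invariance of empty-language bounded formulas under the equality pattern, for finitely many
free variables. -/
theorem empty_language_boundedFormula_realize_iff_of_same_pattern
    {α M N : Type*} [Finite α] [Infinite M] [Infinite N] {v : α → M} {w : α → N} {n : ℕ}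
    (φ : Language.empty.BoundedFormula α n) {xs : Fin n → M} {ys : Fin n → N}
    (h : ∀ a b, Sum.elim v xs a = Sum.elim v xs b ↔ Sum.elim w ys a = Sum.elim w ys b) :
    φ.Realize v xs ↔ φ.Realize w ys := by
  induction φ with
  | falsum => rfl
  | equal t₁ t₂ =>
    rcases t₁ with a | f
    · rcases t₂ with b | f
      · exact h a b
      · exact isEmptyElim f
    · exact isEmptyElim f
  | rel R => exact isEmptyElim R
  | imp _ _ ih₁ ih₂ => exact imp_congr (ih₁ h) (ih₂ h)
  | all φ ih =>
    constructor
    · intro H y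
      obtain ⟨x, hx⟩ := exists_forall_eq_iff_eq_of_same_pattern (fun a b => (h a b).symm) y
      exact (ih (same_pattern_snoc h fun b => (hx b).symm)).1 (H x)
    · intro H x
      obtain ⟨y, hy⟩ := exists_forall_eq_iff_eq_of_same_pattern h x
      exact (ih (same_pattern_snoc h hy)).2 (H y)

/-- Over infinite structures, the truth of an empty-language formula depends only on the
equality pattern of the assignment. -/
theorem empty_language_realize_iff_of_infinite_of_same_pattern
    {α : Type*} (φ : Language.empty.Formula α)
    {M N : Type*} [Infinite M] [Infinite N] (v : α → M) (w : α → N)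
    (h : ∀ i j : α, v i = v j ↔ w i = w j) :
    φ.Realize v ↔ φ.Realize w := by
  classical
  unfold Language.Formula.Realize
  rw [← Language.BoundedFormula.realize_restrictFreeVar' (φ := φ) (v := v) Set.Subset.rfl,
    ← Language.BoundedFormula.realize_restrictFreeVar' (φ := φ) (v := w) Set.Subset.rfl]
  refine empty_language_boundedFormula_realize_iff_of_same_pattern _ ?_
  rintro (a | a) (b | b)
  · exact h a b
  all_goals first | exact a.elim0 | exact b.elim0
end

section
/- For every n : ℕ and every formula φ of the empty first-order language with free variables indexed by Fin n, there exists a threshold N : ℕ such that: for all types M and M' each admitting an injection of Fin N (i.e., each having at least N elements), and all assignments v : Fin n → M and w : Fin n → M' with the same equality pattern, φ.Realize v ↔ φ.Realize w. That is, beyond a formula-dependent finite threshold on the size of the structure, truth depends only on the equality pattern. -/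
open FirstOrder

attribute [local instance] FirstOrder.Language.emptyStructure

universe u uM uN

/-- Two assignments have the same equality pattern if they identify the same pairs of indices. -/
def SameEqualityPattern {ι : Type u} {M : Type uM} {M' : Type uN} (s : ι → M) (t : ι → M') :
    Prop :=
  ∀ i j, s i = s j ↔ t i = t j

theorem SameEqualityPattern.symm {ι : Type u} {M : Type uM} {M' : Type uN} {s : ι → M}
    {t : ι → M'} (h : SameEqualityPattern s t) : SameEqualityPattern t s :=
  fun i j => (h i j).symm

theorem exists_forall_ne_of_natCard_lt {ι : Type u} [Finite ι] {M : Type uM} {N : ℕ}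
    (e : Fin N ↪ M) (hN : Nat.card ι < N) (s : ι → M) : ∃ a, ∀ i, s i ≠ a := by
  by_contra! hs
  choose g hg using hs
  have hinj : Function.Injective (g ∘ e) :=
    (Function.LeftInverse.injective hg).comp e.injective
  have hle := Nat.card_le_card_of_injective _ hinj
  rw [Nat.card_fin] at hle
  omega

/-- The one-point extension step of the back-and-forth argument. -/
theorem SameEqualityPattern.exists_forall_eq_iff {ι : Type u} [Finite ι] {M : Type uM}
    {M' : Type uN} {s : ι → M} {t : ι → M'} (h : SameEqualityPattern s t) {N : ℕ}
    (e : Fin N ↪ M') (hN : Nat.card ι < N) (a : M) : ∃ b : M', ∀ i, s i = a ↔ t i = b := by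
  by_cases ha : ∃ k, s k = a
  · obtain ⟨k, rfl⟩ := ha
    exact ⟨t k, fun i => h i k⟩
  · obtain ⟨b, hb⟩ := exists_forall_ne_of_natCard_lt e hN t
    exact ⟨b, fun i => iff_of_false (fun hi => ha ⟨i, hi⟩) (hb i)⟩

theorem SameEqualityPattern.sumElim_snoc {α : Type u} {M : Type uM} {M' : Type uN} {l : ℕ}
    {v : α → M} {w : α → M'} {xs : Fin l → M} {ys : Fin l → M'}
    (h : SameEqualityPattern (Sum.elim v xs) (Sum.elim w ys)) {a : M} {b : M'}
    (hab : ∀ i, Sum.elim v xs i = a ↔ Sum.elim w ys i = b) :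
    SameEqualityPattern (Sum.elim v (Fin.snoc xs a : Fin (l + 1) → M))
      (Sum.elim w (Fin.snoc ys b : Fin (l + 1) → M')) := by
  have hba : ∀ i, a = Sum.elim v xs i ↔ b = Sum.elim w ys i := fun i => by
    rw [eq_comm, hab i, eq_comm]
  simp only [SameEqualityPattern, Sum.forall, Sum.elim_inl, Sum.elim_inr] at h hab hba
  simp only [SameEqualityPattern, Sum.forall, Sum.elim_inl, Sum.elim_inr, Fin.forall_fin_succ',
    Fin.snoc_castSucc, Fin.snoc_last]
  grind

theorem exists_forall_realize_iff_of_sameEqualityPattern {α : Type u} [Finite α] {l : ℕ}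
    (φ : Language.empty.BoundedFormula α l) :
    ∃ N : ℕ, ∀ (M : Type uM) (M' : Type uN) (_ : Fin N ↪ M) (_ : Fin N ↪ M')
      (v : α → M) (w : α → M') (xs : Fin l → M) (ys : Fin l → M'),
      SameEqualityPattern (Sum.elim v xs) (Sum.elim w ys) →
        (φ.Realize v xs ↔ φ.Realize w ys) := by
  induction φ with
  | falsum => exact ⟨0, fun _ _ _ _ _ _ _ _ _ => Iff.rfl⟩
  | equal t₁ t₂ =>
    refine ⟨0, fun M M' _ _ v w xs ys h => ?_⟩
    rcases t₁ with i | f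
    · rcases t₂ with j | f
      · exact h i j
      · exact isEmptyElim f
    · exact isEmptyElim f
  | rel R => exact isEmptyElim R
  | imp φ ψ ihφ ihψ =>
    obtain ⟨N₁, h₁⟩ := ihφ
    obtain ⟨N₂, h₂⟩ := ihψ
    refine ⟨max N₁ N₂, fun M M' e e' v w xs ys h => ?_⟩
    have c₁ := Fin.castLEEmb (le_max_left N₁ N₂)
    have c₂ := Fin.castLEEmb (le_max_right N₁ N₂)
    exact imp_congr (h₁ M M' (c₁.trans e) (c₁.trans e') v w xs ys h)
      (h₂ M M' (c₂.trans e) (c₂.trans e') v w xs ys h)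
  | @all l φ ih =>
    obtain ⟨N, hN⟩ := ih
    refine ⟨max N (Nat.card (α ⊕ Fin l) + 1), fun M M' e e' v w xs ys h => ?_⟩
    have c := Fin.castLEEmb (le_max_left N (Nat.card (α ⊕ Fin l) + 1))
    have hlt : Nat.card (α ⊕ Fin l) < max N (Nat.card (α ⊕ Fin l) + 1) := by omega
    have step : ∀ a b, (∀ i, Sum.elim v xs i = a ↔ Sum.elim w ys i = b) →
        (φ.Realize v (Fin.snoc xs a) ↔ φ.Realize w (Fin.snoc ys b)) := fun a b hab =>
      hN M M' (c.trans e) (c.trans e') v w _ _ (h.sumElim_snoc hab)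
    constructor
    · intro hφ b
      obtain ⟨a, hab⟩ := h.symm.exists_forall_eq_iff e hlt b
      exact (step a b fun i => (hab i).symm).1 (hφ a)
    · intro hφ a
      obtain ⟨b, hab⟩ := h.exists_forall_eq_iff e' hlt a
      exact (step a b hab).2 (hφ b)

/-- Beyond a formula-dependent finite threshold on the size of the structure, truth of an
empty-language formula depends only on the equality pattern of the assignment. -/
theorem empty_language_realize_iff_of_large_of_same_pattern
    (n : ℕ) (φ : Language.empty.Formula (Fin n)) :
    ∃ N : ℕ, ∀ (M M' : Type) (_ : Nonempty (Fin N ↪ M)) (_ : Nonempty (Fin N ↪ M'))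
      (v : Fin n → M) (w : Fin n → M'),
      (∀ i j : Fin n, v i = v j ↔ w i = w j) → (φ.Realize v ↔ φ.Realize w) := by
  obtain ⟨N, hN⟩ := exists_forall_realize_iff_of_sameEqualityPattern φ
  refine ⟨N, fun M M' ⟨e⟩ ⟨e'⟩ v w h => hN M M' e e' v w _ _ ?_⟩
  rintro (i | i) (j | j)
  · exact h i j
  · exact j.elim0
  · exact i.elim0
  · exact i.elim0
end

section
/- Let φ be a quantifier-free formula of the empty first-order language with free variables indexed by a type α. For any types M and N and any assignments v : α → M and w : α → N with the same equality pattern, φ.Realize v ↔ φ.Realize w. Consequently, a satisfiable quantifier-free formula of the language of equality is determined by the set of equality patterns (partitions of its free variables) that satisfy it. -/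
open FirstOrder

attribute [local instance] FirstOrder.Language.emptyStructure

/-- A quantifier-free formula of the empty first-order language depends only on the equality
pattern of the assignment. -/
theorem empty_language_qf_realize_iff_of_same_pattern
    {α : Type*} (φ : Language.empty.Formula α) (hφ : φ.IsQF)
    {M N : Type*} (v : α → M) (w : α → N)
    (h : ∀ i j : α, v i = v j ↔ w i = w j) :
    φ.Realize v ↔ φ.Realize w := by
  unfold Language.Formula.Realize
  induction hφ with
  | falsum => exact Iff.rfl
  | of_isAtomic hat =>
    cases hat with
    | equal t₁ t₂ =>
      rcases t₁ with (i | i) | ⟨f, _⟩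
      · rcases t₂ with (j | j) | ⟨f, _⟩
        · simpa using h i j
        · exact j.elim0
        · exact isEmptyElim f
      · exact i.elim0
      · exact isEmptyElim f
    | rel R _ => exact isEmptyElim R
  | imp _ _ ih₁ ih₂ => exact imp_congr ih₁ ih₂
end

section
/- For every n : ℕ and every formula φ of the empty first-order language with free variables indexed by Fin n, there exists a set S of setoids (equivalence relations) on Fin n such that for every infinite type M and every assignment v : Fin n → M: φ.Realize v holds if and only if there is some s ∈ S with (for all i j : Fin n, v i = v j ↔ s relates i and j). In other words, over infinite structures every formula of the language of equality is equivalent to a finite disjunction of partition formulas on its free variables. -/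
open FirstOrder

attribute [local instance] FirstOrder.Language.emptyStructure

/-- Two tuples with the same equalities, the first in an infinite type: every one-point extension of
the second tuple is matched by a one-point extension of the first. -/
theorem exists_forall_eq_iff_of_kernel_eq {ι M N : Type*} [Finite ι] [Infinite M]
    {a : ι → M} {b : ι → N} (h : ∀ i j, a i = a j ↔ b i = b j) (y : N) :
    ∃ x, ∀ i, a i = x ↔ b i = y := by
  by_cases hy : ∃ k, b k = y
  · obtain ⟨k, rfl⟩ := hy
    exact ⟨a k, fun i => h i k⟩
  · obtain ⟨x, hx⟩ := (Set.finite_range a).exists_notMem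
    exact ⟨x, fun i => iff_of_false (fun hi => hx ⟨i, hi⟩) (fun hi => hy ⟨i, hi⟩)⟩

theorem sumElim_snoc_map_castSucc {α M : Type*} {l : ℕ} (v : α → M) (xs : Fin l → M) (x : M)
    (k : α ⊕ Fin l) :
    Sum.elim v (Fin.snoc xs x : Fin (l + 1) → M) (Sum.map id Fin.castSucc k) =
      Sum.elim v xs k := by
  cases k <;> simp

theorem sumElim_snoc_kernel_eq {α M N : Type*} {l : ℕ} {v : α → M} {xs : Fin l → M}
    {w : α → N} {ys : Fin l → N} {x : M} {y : N}
    (h : ∀ i j, Sum.elim v xs i = Sum.elim v xs j ↔ Sum.elim w ys i = Sum.elim w ys j)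
    (hxy : ∀ i, Sum.elim v xs i = x ↔ Sum.elim w ys i = y) (i j : α ⊕ Fin (l + 1)) :
    Sum.elim v (Fin.snoc xs x : Fin (l + 1) → M) i =
        Sum.elim v (Fin.snoc xs x : Fin (l + 1) → M) j ↔
      Sum.elim w (Fin.snoc ys y : Fin (l + 1) → N) i =
        Sum.elim w (Fin.snoc ys y : Fin (l + 1) → N) j := by
  have key (k : α ⊕ Fin (l + 1)) : k = Sum.inr (Fin.last l) ∨
      ∃ k' : α ⊕ Fin l, k = Sum.map id Fin.castSucc k' := by
    rcases k with a | k
    · exact Or.inr ⟨Sum.inl a, rfl⟩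
    · induction k using Fin.lastCases with
      | last => exact Or.inl rfl
      | cast k => exact Or.inr ⟨Sum.inr k, rfl⟩
  rcases key i with rfl | ⟨i, rfl⟩ <;> rcases key j with rfl | ⟨j, rfl⟩
  · simp
  · simpa [sumElim_snoc_map_castSucc, eq_comm] using hxy j
  · simpa [sumElim_snoc_map_castSucc] using hxy i
  · simpa [sumElim_snoc_map_castSucc] using h i j

/-- Over infinite structures, the truth of a formula of the language of equality depends only on the
equalities among the values of its variables. -/
theorem realize_iff_of_kernel_eq {α M N : Type*} [Finite α] [Infinite M] [Infinite N] {l : ℕ}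
    (φ : Language.empty.BoundedFormula α l) {v : α → M} {xs : Fin l → M}
    {w : α → N} {ys : Fin l → N}
    (h : ∀ i j, Sum.elim v xs i = Sum.elim v xs j ↔ Sum.elim w ys i = Sum.elim w ys j) :
    φ.Realize v xs ↔ φ.Realize w ys := by
  induction φ with
  | falsum => exact Iff.rfl
  | equal t₁ t₂ =>
    rcases t₁ with i | f
    · rcases t₂ with j | f
      · exact h i j
      · exact isEmptyElim f
    · exact isEmptyElim f
  | rel R => exact isEmptyElim R
  | imp f g hf hg => exact imp_congr (hf h) (hg h)
  | all f hf =>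
    constructor
    · intro H y
      obtain ⟨x, hx⟩ := exists_forall_eq_iff_of_kernel_eq h y
      exact (hf (sumElim_snoc_kernel_eq h hx)).1 (H x)
    · intro H x
      obtain ⟨y, hy⟩ := exists_forall_eq_iff_of_kernel_eq (fun i j => (h i j).symm) x
      exact (hf (sumElim_snoc_kernel_eq h fun i => (hy i).symm)).2 (H y)

/-- Over infinite structures, every formula of the language of equality is equivalent to a
(finite, automatically) disjunction of partition formulas on its free variables. -/
theorem empty_language_formula_eq_disjunction_of_partitions
    (n : ℕ) (φ : Language.empty.Formula (Fin n)) :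
    ∃ S : Set (Setoid (Fin n)), ∀ (M : Type) [Infinite M] (v : Fin n → M),
      φ.Realize v ↔ ∃ s ∈ S, ∀ i j : Fin n, v i = v j ↔ s.r i j := by
  refine ⟨{s | ∃ (N : Type) (_ : Infinite N) (w : Fin n → N), φ.Realize w ∧
    ∀ i j, w i = w j ↔ s.r i j}, fun M _ v => ⟨fun hv => ?_, ?_⟩⟩
  · exact ⟨Setoid.ker v, ⟨M, inferInstance, v, hv, fun _ _ => Iff.rfl⟩, fun _ _ => Iff.rfl⟩
  · rintro ⟨s, ⟨N, _, w, hw, hws⟩, hvs⟩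
    refine (realize_iff_of_kernel_eq φ ?_).2 hw
    rintro (i | i) (j | j)
    · exact (hvs i j).trans (hws i j).symm
    · exact j.elim0
    · exact i.elim0
    · exact i.elim0
end

section
/- Let M be an infinite type and let f : M → N be an injective function into a type N. Then f is an elementary embedding of structures of the empty first-order language: for every n : ℕ, every empty-language formula φ with free variables indexed by Fin n, and every assignment v : Fin n → M, one has φ.Realize (f ∘ v) ↔ φ.Realize v. -/
open FirstOrder

attribute [local instance] FirstOrder.Language.emptyStructure

/-- Given finitely many parameters from an infinite `M`, every point of `N` can be moved into the
range of an injection `f : M → N` by a permutation of `N` fixing the images of the parameters. -/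
theorem exists_perm_apply_eq_of_injective {M N ι : Type*} [Infinite M] [Finite ι] {f : M → N}
    (hf : Function.Injective f) (x : ι → M) (a : N) :
    ∃ (g : Equiv.Perm N) (b : M), g a = f b ∧ ∀ i, g (f (x i)) = f (x i) := by
  classical
  by_cases ha : ∃ i, f (x i) = a
  · obtain ⟨i, rfl⟩ := ha
    exact ⟨1, x i, rfl, fun _ => rfl⟩
  · obtain ⟨b, hb⟩ := (Set.finite_range x).exists_notMem
    refine ⟨Equiv.swap a (f b), b, Equiv.swap_apply_left _ _, fun i => ?_⟩
    exact Equiv.swap_apply_of_ne_of_ne (fun h => ha ⟨i, h⟩) (fun h => hb ⟨i, hf h⟩)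

/-- Any injection from an infinite type is an elementary embedding of empty-language
structures: model completeness of the theory of infinite sets in the language of equality. -/
theorem empty_language_injective_elementary
    {M N : Type*} [Infinite M] (f : M → N) (hf : Function.Injective f) :
    ∀ (n : ℕ) (φ : Language.empty.Formula (Fin n)) (v : Fin n → M),
      φ.Realize (f ∘ v) ↔ φ.Realize v := by
  let F : M ↪[Language.empty] N := Language.StrongHomClass.toEmbedding (⟨f, hf⟩ : M ↪ N)
  refine fun n => F.isElementary_of_exists fun k φ x a h => ?_
  obtain ⟨g, b, hgb, hgx⟩ := exists_perm_apply_eq_of_injective hf x a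
  refine ⟨b, ?_⟩
  have hg := (Language.StrongHomClass.realize_boundedFormula g φ).2 h
  rw [Fin.comp_snoc, hgb, Subsingleton.elim (g ∘ default) default] at hg
  rwa [show g ∘ F ∘ x = F ∘ x from funext hgx] at hg
end

section
/- Let W be a type, let n k : ℕ with 1 ≤ k, let ā : Fin n → W be a tuple, and let Q be a setoid on Fin n. Then the following are equivalent: (1) there exist a type U and a function f : W → U with Nat.card U = k and Setoid.ker (f ∘ ā) = Q; (2) Setoid.ker ā ≤ Q and Nat.card (Quotient Q) ≤ k. That is, a function can carry the tuple ā to a k-element world realizing exactly the equality pattern Q if and only if Q coarsens the pattern of ā and the number of blocks of Q is at most k. -/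
universe u

/-- In the category of sets and arbitrary functions, a function can carry the tuple `ā` to a
`k`-element world realizing exactly the equality pattern `Q` if and only if `Q` coarsens the
pattern of `ā` and the number of blocks of `Q` is at most `k`. -/
theorem exists_fun_card_eq_ker_eq_iff
    {W : Type u} {n k : ℕ} (hk : 1 ≤ k) (a : Fin n → W) (Q : Setoid (Fin n)) :
    (∃ (U : Type u) (f : W → U), Nat.card U = k ∧ Setoid.ker (f ∘ a) = Q) ↔
      (Setoid.ker a ≤ Q ∧ Nat.card (Quotient Q) ≤ k) := by
  constructor
  · rintro ⟨U, f, hU, rfl⟩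
    have : Finite U := Nat.finite_of_card_ne_zero (by omega)
    exact ⟨fun x y h => congrArg f h,
      hU ▸ Nat.card_le_card_of_injective _ (Setoid.kerLift_injective (f ∘ a))⟩
  · rintro ⟨haQ, hQ⟩
    have : NeZero k := ⟨by omega⟩
    have hcard : Nat.card (Quotient Q) ≤ Nat.card (ULift.{u} (Fin k)) := by simpa using hQ
    obtain ⟨e⟩ : Nonempty (Quotient Q ↪ ULift.{u} (Fin k)) := by
      have := Fintype.ofFinite (Quotient Q)
      rw [Nat.card_eq_fintype_card, Nat.card_eq_fintype_card] at hcard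
      exact Function.Embedding.nonempty_of_card_le hcard
    let g : Fin n → ULift.{u} (Fin k) := fun i => e (Quotient.mk Q i)
    have hg : g.FactorsThrough a := fun x y h => congrArg e (Quotient.sound (haQ h))
    refine ⟨ULift.{u} (Fin k), Function.extend a g fun _ => ⟨0⟩, by simp, ?_⟩
    ext x y
    rw [Setoid.ker_def, Function.comp_apply, Function.comp_apply, hg.extend_apply,
      hg.extend_apply]
    exact e.injective.eq_iff.trans Quotient.eq
end

section
/- Let W be a finite nonempty type, let n k : ℕ with 1 ≤ k, let ā : Fin n → W be a tuple, and let Q be a setoid on Fin n. Then the following are equivalent: (1) there exist a type U and a surjective function f : W → U with Nat.card U = k and Setoid.ker (f ∘ ā) = Q; (2) Setoid.ker ā ≤ Q, Nat.card (Quotient Q) ≤ k, and k + Nat.card (Quotient (Setoid.ker ā)) ≤ Nat.card W + Nat.card (Quotient Q). That is, writing P = Setoid.ker ā, a surjection onto a k-element world realizing exactly the pattern Q exists if and only if P refines Q, Q has at most k blocks, and |W| ≥ k + |P| − |Q|, where |P| and |Q| denote the numbers of blocks. -/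
universe u

/-- The number of blocks of the kernel of a function is the cardinality of its range. -/
theorem natCard_quotient_ker {α β : Type*} (f : α → β) :
    Nat.card (Quotient (Setoid.ker f)) = (Set.range f).ncard :=
  (Nat.card_congr (Setoid.quotientKerEquivRange f)).trans (Nat.card_coe_set_eq _)

/-- A surjection out of a finite type cannot have more points outside the image of a set
than there are points outside that set. -/
theorem Function.Surjective.natCard_add_ncard_le {W U : Type*} [Finite W] {f : W → U}
    (hf : Function.Surjective f) (s : Set W) :
    Nat.card U + s.ncard ≤ Nat.card W + (f '' s).ncard := by
  have : Finite U := Finite.of_surjective f hf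
  have hcompl : (f '' s)ᶜ.ncard ≤ sᶜ.ncard :=
    (Set.ncard_le_ncard (Set.subset_image_compl hf)).trans (Set.ncard_image_le sᶜ.toFinite)
  have hW := Set.ncard_add_ncard_compl s
  have hU := Set.ncard_add_ncard_compl (f '' s)
  omega

/-- A map `g` that factors through `a` factors as a surjection after `a`, provided there are
enough points outside the range of `a` to cover the points missed by `g`. -/
theorem exists_surjective_comp_eq {ι W U : Type*} [Finite W] [Finite U] [Nonempty U]
    (a : ι → W) (g : ι → U) (hg : g.FactorsThrough a)
    (hcard : (Set.range g)ᶜ.ncard ≤ (Set.range a)ᶜ.ncard) :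
    ∃ f : W → U, Function.Surjective f ∧ f ∘ a = g := by
  have := Fintype.ofFinite W
  have := Fintype.ofFinite U
  obtain ⟨j⟩ : Nonempty (↥(Set.range g)ᶜ ↪ ↥(Set.range a)ᶜ) := by
    classical
    apply Function.Embedding.nonempty_of_card_le
    simpa only [← Nat.card_eq_fintype_card, Nat.card_coe_set_eq] using hcard
  have hj : Function.Injective fun u => (j u : W) := Subtype.val_injective.comp j.injective
  let f : W → U := Function.extend a g
    (Function.extend (fun u => (j u : W)) Subtype.val fun _ => Classical.arbitrary U)
  have hfa : ∀ i, f (a i) = g i := fun i => hg.extend_apply _ i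
  refine ⟨f, fun u => ?_, funext hfa⟩
  by_cases hu : u ∈ Set.range g
  · obtain ⟨i, rfl⟩ := hu
    exact ⟨a i, hfa i⟩
  · refine ⟨j ⟨u, hu⟩, ?_⟩
    exact (Function.extend_apply' _ _ _ (j ⟨u, hu⟩).2).trans (hj.extend_apply _ _ ⟨u, hu⟩)

/-- In the category of sets and surjections, a surjection from a finite nonempty world `W`
onto a `k`-element world realizing exactly the pattern `Q` exists if and only if `P := ker ā`
refines `Q`, `Q` has at most `k` blocks, and `|W| ≥ k + |P| - |Q|`. -/
theorem exists_surjection_card_eq_ker_eq_iff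
    {W : Type u} [Finite W] [Nonempty W] {n k : ℕ} (hk : 1 ≤ k)
    (a : Fin n → W) (Q : Setoid (Fin n)) :
    (∃ (U : Type u) (f : W → U), Function.Surjective f ∧ Nat.card U = k ∧
        Setoid.ker (f ∘ a) = Q) ↔
      (Setoid.ker a ≤ Q ∧ Nat.card (Quotient Q) ≤ k ∧
        k + Nat.card (Quotient (Setoid.ker a)) ≤ Nat.card W + Nat.card (Quotient Q)) := by
  constructor
  · rintro ⟨U, f, hf, rfl, rfl⟩
    have : Finite U := Finite.of_surjective f hf
    rw [natCard_quotient_ker, natCard_quotient_ker]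
    refine ⟨fun i j h => congrArg f h, Set.ncard_le_card _, ?_⟩
    rw [Set.range_comp]
    exact hf.natCard_add_ncard_le _
  · rintro ⟨hle, hQ, hcard⟩
    let U := ULift.{u} (Fin k)
    have hU : Nat.card U = k := by simp [U]
    have : Nonempty U := ⟨⟨⟨0, hk⟩⟩⟩
    obtain ⟨e⟩ : Nonempty (Quotient Q ↪ U) := by
      have := Fintype.ofFinite (Quotient Q)
      apply Function.Embedding.nonempty_of_card_le
      rwa [← Nat.card_eq_fintype_card, ← Nat.card_eq_fintype_card, hU]
    let g : Fin n → U := fun i => e (Quotient.mk Q i)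
    have hker : Setoid.ker g = Q :=
      Setoid.ext fun i j => e.injective.eq_iff.trans Quotient.eq
    obtain ⟨f, hf, hfa⟩ := exists_surjective_comp_eq a g
      (fun i j h => congrArg e (Quotient.sound (hle h))) (by
        rw [← hker, natCard_quotient_ker, natCard_quotient_ker] at hcard
        have hW := Set.ncard_add_ncard_compl (Set.range a)
        have hg := Set.ncard_add_ncard_compl (Set.range g)
        omega)
    exact ⟨U, f, hf, hU, hfa ▸ hker⟩
end

section
/- Let W be an infinite type, let ā : Fin n → W be a tuple, and let Q be a setoid on Fin n with Setoid.ker ā ≤ Q. Then there exist an infinite type U and a surjective function f : W → U such that Setoid.ker (f ∘ ā) = Q and f makes no identifications other than those required by Q: for all x y : W, if f x = f y then either x = y or there are indices i j : Fin n with x = ā i, y = ā j, and Q relates i and j. -/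
universe u

/-- The finest equivalence relation on `W` that identifies `a i` with `a j` whenever `Q` relates
`i` and `j`, for a coarsening `Q` of the kernel of `a`. -/
def Setoid.pushforwardOfKerLE {ι W : Type*} (a : ι → W) (Q : Setoid ι)
    (hle : Setoid.ker a ≤ Q) : Setoid W where
  r x y := x = y ∨ ∃ i j, x = a i ∧ y = a j ∧ Q i j
  iseqv :=
    { refl := fun _ => Or.inl rfl
      symm := by
        rintro x y (rfl | ⟨i, j, hx, hy, hij⟩)
        · exact Or.inl rfl
        · exact Or.inr ⟨j, i, hy, hx, Q.symm hij⟩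
      trans := by
        rintro x y z (rfl | ⟨i, j, hx, hy, hij⟩) (rfl | ⟨k, l, hy', hz, hkl⟩)
        · exact Or.inl rfl
        · exact Or.inr ⟨k, l, hy', hz, hkl⟩
        · exact Or.inr ⟨i, j, hx, hy, hij⟩
        · have hjk : Q j k := hle (hy.symm.trans hy')
          exact Or.inr ⟨i, l, hx, hz, Q.trans hij (Q.trans hjk hkl)⟩ }

/-- Identifying only the finitely many parameter-values required by a coarsening `Q` of the
tuple's equality pattern yields a surjection onto a still-infinite world realizing exactly `Q`,
with no other identifications. -/
theorem infinite_exists_surjection_ker_eq_minimal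
    {W : Type u} [Infinite W] {n : ℕ} (a : Fin n → W) (Q : Setoid (Fin n))
    (hle : Setoid.ker a ≤ Q) :
    ∃ (U : Type u) (f : W → U), Infinite U ∧ Function.Surjective f ∧
      Setoid.ker (f ∘ a) = Q ∧
      ∀ x y : W, f x = f y →
        x = y ∨ ∃ i j : Fin n, x = a i ∧ y = a j ∧ Q.r i j := by
  let S : Setoid W := Setoid.pushforwardOfKerLE a Q hle
  have hS : ∀ x y : W, (Quotient.mk S x = Quotient.mk S y) ↔
      (x = y ∨ ∃ i j : Fin n, x = a i ∧ y = a j ∧ Q i j) := fun _ _ => Quotient.eq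
  refine ⟨Quotient S, Quotient.mk S, ?_, Quotient.mk_surjective, ?_, fun x y h => (hS x y).1 h⟩
  · have : Infinite ↥(Set.range a)ᶜ := (Set.finite_range a).infinite_compl.to_subtype
    refine Infinite.of_injective (fun x : ↥(Set.range a)ᶜ => Quotient.mk S x.1) fun x y h => ?_
    rcases (hS _ _).1 h with h | ⟨i, -, hx, -⟩
    · exact Subtype.ext h
    · exact absurd ⟨i, hx.symm⟩ x.2
  · ext i j
    refine (hS (a i) (a j)).trans ⟨?_, fun h => Or.inr ⟨i, j, rfl, rfl, h⟩⟩
    rintro (h | ⟨k, l, hk, hl, hkl⟩)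
    · exact hle h
    · exact Q.trans (hle hk) (Q.trans hkl (hle hl.symm))
end
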